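/- Let G be the group with presentation ⟨γ₁, γ₂ ∣ (γ₁γ₂)³ = (γ₂γ₁)³⟩ (the Artin group of type I₂(6)). Then the center of G is the cyclic subgroup generated by Δ = (γ₁γ₂)³, i.e. an element g ∈ G is central if and only if g is an integer power of the image of (γ₁γ₂)³ in G. -/

import Mathlib

/-- The single relation `(γ₁γ₂)³ = (γ₂γ₁)³` of the Artin group of type `I₂(6)`,
written as a relator in the free group on two generators. -/
def artinI26Rels : Set (FreeGroup (Fin 2)) :=
  {(FreeGroup.of 0 * FreeGroup.of 1) ^ 3 * ((FreeGroup.of 1 * FreeGroup.of 0) ^ 3)⁻¹}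

open Monoid

/-- In a free product of groups, the end indices of a nonempty reduced word are determined by
its product. -/
theorem Monoid.CoprodI.NeWord.index_eq_of_prod_eq {ι : Type*} {M : ι → Type*}
    [∀ i, Group (M i)] {i j k l : ι} (v : CoprodI.NeWord M i j) (w : CoprodI.NeWord M k l)
    (h : v.prod = w.prod) : i = k ∧ j = l := by
  classical
  have hword : v.toWord = w.toWord := CoprodI.Word.equiv.symm.injective h
  have hlist : v.toList = w.toList := congrArg CoprodI.Word.toList hword
  constructor
  · have := v.toList_head?
    rw [hlist, w.toList_head?] at this
    exact (congrArg Sigma.fst (Option.some.inj this)).symm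
  · have := v.toList_getLast?
    rw [hlist, w.toList_getLast?] at this
    exact (congrArg Sigma.fst (Option.some.inj this)).symm

/-- A free product of at least two groups, each with at least three elements, is centerless. -/
theorem Monoid.CoprodI.center_eq_bot {ι : Type*} [Nontrivial ι] {M : ι → Type*}
    [∀ i, Group (M i)] (hM : ∀ i (x : M i), ∃ y : M i, y ≠ 1 ∧ y * x ≠ 1) :
    Subgroup.center (CoprodI M) = ⊥ := by
  classical
  refine (Subgroup.eq_bot_iff_forall _).2 fun z hz ↦ ?_
  by_contra hne
  have hnonempty : CoprodI.Word.equiv z ≠ CoprodI.Word.empty := fun h ↦ hne <| by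
    rw [← CoprodI.Word.equiv.symm_apply_apply z, h]
    exact CoprodI.Word.prod_empty
  obtain ⟨i, j, w, hw⟩ := CoprodI.NeWord.of_word _ hnonempty
  have hprod : w.prod = z := by
    rw [CoprodI.NeWord.prod, hw]
    exact CoprodI.Word.equiv.symm_apply_apply z
  have hcomm (g : CoprodI M) : g * w.prod = w.prod * g := by
    rw [hprod]
    exact Subgroup.mem_center_iff.1 hz g
  by_cases hij : i = j
  · subst hij
    obtain ⟨k, hk⟩ := exists_ne i
    obtain ⟨y, hy, -⟩ := hM k 1
    refine hk (CoprodI.NeWord.index_eq_of_prod_eq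
      (.append (.singleton y hy) hk w) (.append w hk.symm (.singleton y hy)) ?_).1
    simpa using hcomm (CoprodI.of y)
  · obtain ⟨y, hy, hyw⟩ := hM i w.head
    refine hij (CoprodI.NeWord.index_eq_of_prod_eq
      (w.mulHead y hyw) (.append w (Ne.symm hij) (.singleton y hy)) ?_).2.symm
    simpa using hcomm (CoprodI.of y)

namespace ArtinI26

/-- The orders of the free factors of `ℤ * ℤ/3`, where `0` stands for infinite order. -/
def factorOrder : Bool → ℕ
  | false => 0
  | true => 3

/-- The free factors of `ℤ * ℤ/3`. -/
abbrev Factor (b : Bool) : Type := Multiplicative (ZMod (factorOrder b))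

theorem exists_factor_ne_one (b : Bool) (x : Factor b) : ∃ y : Factor b, y ≠ 1 ∧ y * x ≠ 1 := by
  cases b
  · change ∃ y : ℤ, y ≠ 0 ∧ y + (show ℤ from x) ≠ 0
    generalize (show ℤ from x) = n
    by_cases h : 1 + n = 0
    · exact ⟨2, by omega, by omega⟩
    · exact ⟨1, by omega, h⟩
  · change ∃ y : ZMod 3, y ≠ 0 ∧ y + (show ZMod 3 from x) ≠ 0
    generalize (show ZMod 3 from x) = n
    revert n
    decide

/-- The generator of a free factor, inside `ℤ * ℤ/3`. -/
def factorGen (b : Bool) : CoprodI Factor :=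
  CoprodI.of (i := b) (Multiplicative.ofAdd (1 : ZMod (factorOrder b)))

theorem factorGen_true_pow_three : factorGen true ^ 3 = 1 := by
  rw [factorGen, ← map_pow]
  exact (congrArg _ (show Multiplicative.ofAdd (1 : ZMod 3) ^ 3 = 1 by decide)).trans (map_one _)

/-- Elements `x b` of a group with `x b ^ factorOrder b = 1` define a homomorphism on
`ℤ * ℤ/3`. -/
def factorLift {N : Type*} [Group N] (x : Bool → N) (hx : ∀ b, x b ^ factorOrder b = 1) :
    CoprodI Factor →* N :=
  CoprodI.lift fun b ↦ AddMonoidHom.toMultiplicativeLeft <| ZMod.lift (factorOrder b)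
    ⟨zmultiplesHom (Additive N) (Additive.ofMul (x b)), by
      simpa using congrArg Additive.ofMul (hx b)⟩

theorem factorLift_gen {N : Type*} [Group N] (x : Bool → N) (hx : ∀ b, x b ^ factorOrder b = 1)
    (b : Bool) : factorLift x hx (factorGen b) = x b := by
  have h := ZMod.lift_coe (factorOrder b)
    (⟨zmultiplesHom (Additive N) (Additive.ofMul (x b)), by
      simpa using congrArg Additive.ofMul (hx b)⟩ :
        {f : ℤ →+ Additive N // f (factorOrder b) = 0}) 1
  simp only [Int.cast_one, zmultiplesHom_apply, one_smul] at h
  rw [factorLift, factorGen, CoprodI.lift_of]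
  exact congrArg Additive.toMul h

/-- The Artin group of type `I₂(6)`. -/
abbrev ArtinGroup : Type := PresentedGroup artinI26Rels

/-- The standard generators of the Artin group. -/
abbrev gen (i : Fin 2) : ArtinGroup := PresentedGroup.of i

/-- The element `(γ₁γ₂)³`. -/
abbrev delta : ArtinGroup := (gen 0 * gen 1) ^ 3

theorem delta_eq : delta = (gen 1 * gen 0) ^ 3 :=
  mul_inv_eq_one.1 (PresentedGroup.one_of_mem (rels := artinI26Rels) rfl)

theorem delta_mem_center : delta ∈ Subgroup.center ArtinGroup := by
  have hzero : gen 0 * delta = delta * gen 0 := by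
    conv_lhs => rw [delta_eq]
    simp only [delta, pow_succ, pow_zero, one_mul, mul_assoc]
  have hone : gen 1 * delta = delta * gen 1 := by
    conv_rhs => rw [delta_eq]
    simp only [delta, pow_succ, pow_zero, one_mul, mul_assoc]
  have hle : (⊤ : Subgroup ArtinGroup) ≤ Subgroup.centralizer {delta} := by
    rw [← PresentedGroup.closure_range_of artinI26Rels, Subgroup.closure_le]
    rintro _ ⟨i, rfl⟩
    rw [SetLike.mem_coe, Subgroup.mem_centralizer_singleton_iff]
    fin_cases i
    · exact hzero
    · exact hone
  refine Subgroup.mem_center_iff.2 fun g ↦ ?_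
  exact Subgroup.mem_centralizer_singleton_iff.1 (hle (Subgroup.mem_top g))

instance zpowers_delta_normal : (Subgroup.zpowers delta).Normal :=
  ⟨fun n hn g ↦ by
    have hcenter := (Subgroup.zpowers_le.2 delta_mem_center) hn
    rwa [Subgroup.mem_center_iff.1 hcenter g, mul_inv_cancel_right]⟩

/-- The map `γ₁ ↦ a`, `γ₂ ↦ a⁻¹x` to `ℤ * ℤ/3 = ⟨a⟩ * ⟨x⟩`. -/
def toCoprod : ArtinGroup →* CoprodI Factor :=
  PresentedGroup.toGroup (f := ![factorGen false, (factorGen false)⁻¹ * factorGen true]) <| by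
    rintro r rfl
    have h := factorGen_true_pow_three
    have hconj : ((factorGen false)⁻¹ * factorGen true * factorGen false) ^ 3 = 1 := by
      simpa [h] using conj_pow (i := 3) (a := (factorGen false)⁻¹) (b := factorGen true)
    simp [h, hconj]

theorem toCoprod_gen_zero : toCoprod (gen 0) = factorGen false :=
  PresentedGroup.toGroup.of _

theorem toCoprod_gen_one : toCoprod (gen 1) = (factorGen false)⁻¹ * factorGen true :=
  PresentedGroup.toGroup.of _

theorem toCoprod_surjective : Function.Surjective toCoprod := by
  have hgen (b : Bool) : factorGen b ∈ toCoprod.range := by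
    cases b
    · exact ⟨gen 0, toCoprod_gen_zero⟩
    · exact ⟨gen 0 * gen 1, by simp [toCoprod_gen_zero, toCoprod_gen_one]⟩
  intro z
  induction z using CoprodI.induction_on with
  | one => exact ⟨1, map_one _⟩
  | of b m =>
    obtain ⟨n, hn⟩ := ZMod.intCast_surjective m.toAdd
    have hm : m = Multiplicative.ofAdd (1 : ZMod (factorOrder b)) ^ n := by
      rw [← ofAdd_zsmul, zsmul_one, hn, ofAdd_toAdd]
    rw [hm, map_zpow]
    exact zpow_mem (hgen b) n
  | mul y z hy hz =>
    obtain ⟨g, rfl⟩ := hy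
    obtain ⟨h, rfl⟩ := hz
    exact ⟨g * h, map_mul _ _ _⟩

theorem ker_toCoprod_le : toCoprod.ker ≤ Subgroup.zpowers delta := by
  let q := QuotientGroup.mk' (Subgroup.zpowers delta)
  let x (b : Bool) : ArtinGroup ⧸ Subgroup.zpowers delta :=
    cond b (q (gen 0 * gen 1)) (q (gen 0))
  have hx (b : Bool) : x b ^ factorOrder b = 1 := by
    cases b
    · exact pow_zero _
    · change q (gen 0 * gen 1) ^ 3 = 1
      rw [← map_pow]
      exact (QuotientGroup.eq_one_iff _).2 (Subgroup.mem_zpowers delta)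
  have hcomp : (factorLift x hx).comp toCoprod = q := by
    refine PresentedGroup.ext fun i ↦ ?_
    fin_cases i
    · change factorLift x hx (toCoprod (gen 0)) = q (gen 0)
      rw [toCoprod_gen_zero, factorLift_gen]
      rfl
    · change factorLift x hx (toCoprod (gen 1)) = q (gen 1)
      rw [toCoprod_gen_one, map_mul, map_inv, factorLift_gen, factorLift_gen]
      change (q (gen 0))⁻¹ * q (gen 0 * gen 1) = q (gen 1)
      rw [map_mul, inv_mul_cancel_left]
  intro g hg
  rw [← QuotientGroup.eq_one_iff]
  change q g = 1
  rw [← hcomp, MonoidHom.comp_apply, MonoidHom.mem_ker.1 hg, map_one]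

theorem center_le_zpowers_delta : Subgroup.center ArtinGroup ≤ Subgroup.zpowers delta := by
  refine fun g hg ↦ ker_toCoprod_le (MonoidHom.mem_ker.2 ?_)
  rw [← Subgroup.mem_bot, ← CoprodI.center_eq_bot exists_factor_ne_one, Subgroup.mem_center_iff]
  intro z
  obtain ⟨h, rfl⟩ := toCoprod_surjective z
  rw [← map_mul, ← map_mul, Subgroup.mem_center_iff.1 hg h]

end ArtinI26

/-- in the group `G = ⟨γ₁, γ₂ ∣ (γ₁γ₂)³ = (γ₂γ₁)³⟩`, an element is
central iff it is an integer power of `Δ = (γ₁γ₂)³`. -/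
theorem stmt_9 (g : PresentedGroup artinI26Rels) :
    g ∈ Subgroup.center (PresentedGroup artinI26Rels) ↔
      ∃ k : ℤ,
        g = ((PresentedGroup.of (rels := artinI26Rels) 0 *
              PresentedGroup.of (rels := artinI26Rels) 1) ^ 3) ^ k := by
  constructor
  · intro hg
    obtain ⟨k, hk⟩ := Subgroup.mem_zpowers_iff.1 (ArtinI26.center_le_zpowers_delta hg)
    exact ⟨k, hk.symm⟩
  · rintro ⟨k, rfl⟩
    exact zpow_mem ArtinI26.delta_mem_center k
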